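/- arXiv:math/9409232 — 3 statements merged into one kernel-verified Lean document; each statement's English description precedes it below -/
import Mathlib

section
/- Let A and B be positive real numbers, define f : ℝ → ℝ by f(t) = (A·e^{-t} + B·e^{t})/2, let a ≤ b be real numbers, and let s ∈ [a,b] be a point at which f attains its minimum over the interval [a,b]. Then for every t ∈ [a,b] one has (1/2)·f(s)·e^{|t−s|} ≤ f(t) ≤ 2·f(s)·e^{|t−s|}. -/
theorem growth_core (P Q d : ℝ) (hP : 0 < P) (hQ : 0 < Q) (hd : 0 ≤ d)
    (h : ∀ u, 0 ≤ u → u ≤ d → P + Q ≤ P * Real.exp (-u) + Q * Real.exp u) :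
    (1 / 2) * (P + Q) * Real.exp d ≤ P * Real.exp (-d) + Q * Real.exp d ∧
    P * Real.exp (-d) + Q * Real.exp d ≤ 2 * (P + Q) * Real.exp d := by
  have hE : Real.exp (-d) ≤ Real.exp d := Real.exp_le_exp.2 (by linarith)
  have hE0 := Real.exp_pos (-d)
  have hE1 := Real.exp_pos d
  constructor
  · rcases hd.eq_or_lt with rfl | hd
    · simp; linarith
    have hPQ : P ≤ Q := by
      by_contra! hlt
      have hL : 0 < Real.log (P / Q) := Real.log_pos ((one_lt_div hQ).2 hlt)
      set u := min d (Real.log (P / Q) / 2) with hu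
      have hu0 : 0 < u := lt_min hd (by linarith)
      have hu2 : u < Real.log (P / Q) := (min_le_right _ _).trans_lt (by linarith)
      have h1 := h u hu0.le (min_le_left _ _)
      have h2 : Real.exp u < P / Q := (Real.lt_log_iff_exp_lt (by positivity)).1 hu2
      rw [lt_div_iff₀ hQ] at h2
      have h3 : 1 < Real.exp u := Real.one_lt_exp_iff.2 hu0
      have h4 : Real.exp (-u) * Real.exp u = 1 := by rw [← Real.exp_add]; simp
      have h5 := mul_le_mul_of_nonneg_right h1 (Real.exp_pos u).le
      have h6 : (P * Real.exp (-u) + Q * Real.exp u) * Real.exp u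
          = P + Q * Real.exp u * Real.exp u := by
        linear_combination P * h4
      nlinarith [mul_pos (sub_pos.2 h3) (sub_pos.2 h2)]
    nlinarith [mul_nonneg (sub_nonneg.2 hPQ) hE1.le, mul_pos hP hE0]
  · nlinarith [mul_le_mul_of_nonneg_left hE hP.le, mul_pos hP hE1, mul_pos hQ hE1]

/-- For positive reals `A`, `B`, the function
`f t = (A·e^{-t} + B·e^{t})/2`, and `s` a minimizer of `f` over an interval
`[a,b]`, one has `(1/2)·f(s)·e^{|t−s|} ≤ f(t) ≤ 2·f(s)·e^{|t−s|}` for all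
`t ∈ [a,b]`. -/
theorem sum_of_exponentials_growth_interval (A B : ℝ) (hA : 0 < A) (hB : 0 < B)
    (f : ℝ → ℝ) (hf : ∀ t, f t = (A * Real.exp (-t) + B * Real.exp t) / 2)
    (a b : ℝ) (hab : a ≤ b) (s : ℝ) (hs : s ∈ Set.Icc a b)
    (hmin : ∀ t ∈ Set.Icc a b, f s ≤ f t) :
    ∀ t ∈ Set.Icc a b, (1 / 2) * f s * Real.exp |t - s| ≤ f t ∧
      f t ≤ 2 * f s * Real.exp |t - s| := by
  intro t ht
  have e1 : ∀ u, f (s + u) = (A * Real.exp (-s) * Real.exp (-u) + B * Real.exp s * Real.exp u) / 2 := by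
    intro u
    rw [hf, neg_add, Real.exp_add, Real.exp_add]; ring
  have e0 : f s = (A * Real.exp (-s) + B * Real.exp s) / 2 := hf s
  have hP : 0 < A * Real.exp (-s) := by positivity
  have hQ : 0 < B * Real.exp s := by positivity
  rcases le_total s t with hst | hst
  · rw [abs_of_nonneg (sub_nonneg.2 hst)]
    have key := growth_core _ _ (t - s) hP hQ (sub_nonneg.2 hst) (by
      intro u h0 h1
      have := hmin (s + u) ⟨by linarith [hs.1], by linarith [ht.2]⟩
      rw [e1, e0] at this
      linarith)
    have e2 := e1 (t - s)
    rw [add_sub_cancel] at e2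
    rw [e2, e0]
    constructor <;> linarith [key.1, key.2]
  · rw [abs_of_nonpos (sub_nonpos.2 hst), neg_sub]
    have key := growth_core _ _ (s - t) hQ hP (sub_nonneg.2 hst) (by
      intro u h0 h1
      have := hmin (s + -u) ⟨by linarith [ht.1], by linarith [hs.2]⟩
      rw [e1, e0, neg_neg] at this
      linarith)
    have e2 := e1 (-(s - t))
    rw [neg_neg, show s + -(s - t) = t by ring] at e2
    rw [e2, e0]
    constructor <;> linarith [key.1, key.2]
end

section
/- Let A and B be positive real numbers, define f : ℝ → ℝ by f(t) = (A·e^{-t} + B·e^{t})/2, let a ≤ b be real numbers, let c₀ ≥ 1, and let E : ℝ → ℝ satisfy f(t) ≤ E(t) ≤ c₀·f(t) for all t ∈ [a,b]. Let s ∈ [a,b] be a point at which f attains its minimum over [a,b]. Then every point t₀ ∈ [a,b] at which E attains its minimum over [a,b] satisfies |t₀ − s| ≤ 2·log(2·c₀). -/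
lemma aux_bound (P Q d c : ℝ) (hP : 0 < P) (hQ : 0 < Q) (hd : 0 < d) (hc : 1 ≤ c)
    (h1 : P + Q ≤ P * Real.exp (-(d / 2)) + Q * Real.exp (d / 2))
    (h2 : P * Real.exp (-d) + Q * Real.exp d ≤ c * (P + Q)) :
    d ≤ 2 * Real.log (2 * c) := by
  have hx : 1 < Real.exp (d / 2) := Real.one_lt_exp_iff.2 (by linarith)
  have hxx : Real.exp d = Real.exp (d / 2) * Real.exp (d / 2) := by
    rw [← Real.exp_add]; congr 1; ring
  have hy : Real.exp (-(d / 2)) * Real.exp (d / 2) = 1 := by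
    rw [← Real.exp_add]; simp
  have hn : 0 < P * Real.exp (-d) := by positivity
  have key : Real.exp (d / 2) ≤ 2 * c := by
    rw [hxx] at h2
    generalize Real.exp (d / 2) = x at *
    generalize Real.exp (-(d / 2)) = y at *
    have hPQ : P ≤ Q * x := by
      by_contra! h
      have h3 : (P + Q) * x ≤ P + Q * x * x := by
        have := mul_le_mul_of_nonneg_right h1 (by linarith : (0 : ℝ) ≤ x)
        have e : (P * y + Q * x) * x = P * (y * x) + Q * x * x := by ring
        rw [e, hy] at this
        linarith
      nlinarith [mul_pos (sub_pos.2 h) (sub_pos.2 hx)]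
    have h4 : P + Q ≤ 2 * (Q * x) := by nlinarith
    have h5 : c * (P + Q) ≤ c * (2 * (Q * x)) := mul_le_mul_of_nonneg_left h4 (by linarith)
    have h6 : 0 < Q * x := by nlinarith
    have h7 : (Q * x) * x ≤ (Q * x) * (2 * c) := by nlinarith
    exact le_of_mul_le_mul_left h7 h6
  have := (Real.le_log_iff_exp_le (by linarith : (0 : ℝ) < 2 * c)).2 key
  linarith

/-- If `E` is multiplicatively comparable with constant `c₀ ≥ 1`
on `[a,b]` to `f t = (A·e^{-t} + B·e^{t})/2` (`A, B > 0`), and `s` minimizes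
`f` over `[a,b]`, then every minimizer `t₀` of `E` over `[a,b]` satisfies
`|t₀ − s| ≤ 2·log (2·c₀)`. -/
theorem minimizers_close (A B : ℝ) (hA : 0 < A) (hB : 0 < B)
    (f : ℝ → ℝ) (hf : ∀ t, f t = (A * Real.exp (-t) + B * Real.exp t) / 2)
    (a b : ℝ) (hab : a ≤ b) (c₀ : ℝ) (hc₀ : 1 ≤ c₀)
    (E : ℝ → ℝ) (hE : ∀ t ∈ Set.Icc a b, f t ≤ E t ∧ E t ≤ c₀ * f t)
    (s : ℝ) (hs : s ∈ Set.Icc a b)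
    (hmin : ∀ t ∈ Set.Icc a b, f s ≤ f t) :
    ∀ t₀ ∈ Set.Icc a b, (∀ t ∈ Set.Icc a b, E t₀ ≤ E t) →
      |t₀ - s| ≤ 2 * Real.log (2 * c₀) := by
  intro t₀ ht₀ hE₀
  have h := ((hE t₀ ht₀).1.trans (hE₀ s hs)).trans (hE s hs).2
  have hm : (t₀ + s) / 2 ∈ Set.Icc a b := by
    constructor <;> linarith [hs.1, hs.2, ht₀.1, ht₀.2]
  have h' := hmin _ hm
  rw [hf, hf] at h h'
  have ex : ∀ u v w : ℝ, w = u + v → Real.exp w = Real.exp u * Real.exp v := by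
    rintro u v w rfl
    exact Real.exp_add u v
  rcases lt_trichotomy t₀ s with hlt | heq | hlt
  · rw [abs_of_neg (by linarith)]
    apply aux_bound (B * Real.exp s) (A * Real.exp (-s)) _ c₀ (by positivity) (by positivity)
      (by linarith) hc₀
    · rw [ex (-s) (-(t₀ - s) / 2) (-((t₀ + s) / 2)) (by ring),
        ex s (-(-(t₀ - s) / 2)) ((t₀ + s) / 2) (by ring)] at h'
      linarith
    · rw [ex (-s) (-(t₀ - s)) (-t₀) (by ring), ex s (-(-(t₀ - s))) t₀ (by ring)] at h
      linarith
  · subst heq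
    have := Real.log_nonneg (by linarith : (1 : ℝ) ≤ 2 * c₀)
    simpa using this
  · rw [abs_of_pos (by linarith)]
    apply aux_bound (A * Real.exp (-s)) (B * Real.exp s) _ c₀ (by positivity) (by positivity)
      (by linarith) hc₀
    · rw [ex (-s) (-((t₀ - s) / 2)) (-((t₀ + s) / 2)) (by ring),
        ex s ((t₀ - s) / 2) ((t₀ + s) / 2) (by ring)] at h'
      linarith
    · rw [ex (-s) (-(t₀ - s)) (-t₀) (by ring), ex s (t₀ - s) t₀ (by ring)] at h
      linarith
end

section
/- Let X be a metric space with distance d, let L ⊆ X be a nonempty subset, and for x ∈ X let π(x) = {y ∈ L : d(x, y) = infDist(x, L)} be the set of closest points of L to x. Assume π(x) is nonempty for every x ∈ X. Suppose b₁, b₂ ≥ 0 are constants such that for all σ, τ ∈ X, if infDist(σ, L) > b₁ and d(σ, τ) ≤ infDist(σ, L) − b₁, then the diameter of π(σ) ∪ π(τ) is at most b₂. Then for all σ, τ ∈ X, the diameter of π(σ) ∪ π(τ) is at most max(b₂, 4·d(σ, τ) + 2·b₁). -/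
/-- If the closest-points projection `π` to a nonempty set `L`
in a metric space is everywhere nonempty and satisfies the 'contraction at a
distance' property with constants `b₁, b₂ ≥ 0`, then for all `σ, τ` the
diameter of `π σ ∪ π τ` is at most `max b₂ (4·d(σ,τ) + 2·b₁)`. -/
theorem cusp_projection_case_analysis {X : Type*} [MetricSpace X]
    (L : Set X) (hL : L.Nonempty)
    (π : X → Set X)
    (hπ : ∀ x, π x = {y ∈ L | dist x y = Metric.infDist x L})
    (hne : ∀ x, (π x).Nonempty)
    (b₁ b₂ : ℝ) (hb₁ : 0 ≤ b₁) (hb₂ : 0 ≤ b₂)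
    (hcontr : ∀ σ τ : X, b₁ < Metric.infDist σ L →
      dist σ τ ≤ Metric.infDist σ L - b₁ →
      Metric.diam (π σ ∪ π τ) ≤ b₂) :
    ∀ σ τ : X, Metric.diam (π σ ∪ π τ) ≤ max b₂ (4 * dist σ τ + 2 * b₁) := by
  intro σ τ
  by_cases h : b₁ < Metric.infDist σ L ∧ dist σ τ ≤ Metric.infDist σ L - b₁
  · exact le_max_of_le_left (hcontr σ τ h.1 h.2)
  · have hd : 0 ≤ dist σ τ := dist_nonneg
    have hD : Metric.infDist σ L ≤ dist σ τ + b₁ := by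
      by_contra hc
      push Not at hc
      exact h ⟨by linarith, by linarith⟩
    have hT : Metric.infDist τ L ≤ Metric.infDist σ L + dist τ σ :=
      Metric.infDist_le_infDist_add_dist
    have hcomm : dist τ σ = dist σ τ := dist_comm _ _
    apply le_max_of_le_right
    apply Metric.diam_le_of_forall_dist_le (by linarith)
    intro x hx y hy
    rw [hπ σ, hπ τ] at hx hy
    have e1 := dist_triangle_left x y σ
    have e2 := dist_triangle_left x y τ
    have e3 := dist_triangle σ τ x
    have e4 := dist_triangle σ τ y
    rcases hx with ⟨_, hx⟩ | ⟨_, hx⟩ <;> rcases hy with ⟨_, hy⟩ | ⟨_, hy⟩ <;> linarith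
end
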